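/- Fix γ ∈ (0,1) and R ∈ (0,γ). There exist δ > 0 (the tent-width parameter of F) and ε ∈ (0,1) such that, defining the initial-state measure μ₀ = ((1−ε)/2)·δ_{x⋆} + ((1−ε)/2)·δ_{y⋆} + (ε/10)·(Lebesgue measure restricted to (−5,5)), the total cost 𝒞(θ₀,θ₁) = ∫ C[z](θ₀,θ₁) dμ₀(z) has a local minimum at (θ₀,θ₁) = (0,1); more precisely, there exists r > 0 such that 𝒞((0,1)+dθ) > 𝒞((0,1)) for every dθ ∈ ℝ² with 0 < ‖dθ‖ < r. -/

import Mathlib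

open MeasureTheory

/-- The tent (spike) function of width `2δ` centered at `a`. -/
noncomputable def tent (a δ x : ℝ) : ℝ :=
  if x ∈ Set.Icc (a - δ) a then (x - (a - δ)) / δ
  else if x ∈ Set.Icc a (a + δ) then ((a + δ) - x) / δ
  else 0

/-- The nonlinear feature `F(x) = ω₀|x| + Σᵢ ωᵢ Λ_{aᵢ,δᵢ}(x)` with the paper's parameters
`ω₀ = −0.5, a₁ = −2, δ₁ = 0.1, ω₁ = 3, a₂ = 1.5, a₃ = 1.8, ω₂ = ω₃ = 0.2, δ₂ = δ₃ = δ`. -/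
noncomputable def Fex (δ x : ℝ) : ℝ :=
  (-0.5) * |x| + 3 * tent (-2) 0.1 x + 0.2 * tent 1.5 δ x + 0.2 * tent 1.8 δ x

/-- The closed-loop trajectory: `x₀ = z`, `x_{t+1} = u_t = θ₀ x_t + θ₁ F(x_t)`. -/
noncomputable def traj (δ : ℝ) (θ : ℝ × ℝ) (z : ℝ) : ℕ → ℝ
  | 0 => z
  | t + 1 => θ.1 * traj δ θ z t + θ.2 * Fex δ (traj δ θ z t)

/-- The discounted cost `C[z](θ) = Σ_t γᵗ (x_t² + R u_t²)` (note `u_t = x_{t+1}`). -/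
noncomputable def cost (γ R δ : ℝ) (θ : ℝ × ℝ) (z : ℝ) : ℝ :=
  ∑' t : ℕ, γ ^ t * ((traj δ θ z t) ^ 2 + R * (traj δ θ z (t + 1)) ^ 2)

/-- `x⋆ = min F⁻¹({a₂})`, the smallest preimage of `a₂ = 1.5` under `F`. -/
noncomputable def xstar (δ : ℝ) : ℝ := sInf {x : ℝ | Fex δ x = 1.5}

/-- `y⋆ = min F⁻¹({a₃})`, the smallest preimage of `a₃ = 1.8` under `F`. -/
noncomputable def ystar (δ : ℝ) : ℝ := sInf {x : ℝ | Fex δ x = 1.8}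

/-- The ℓ¹ norm `‖(a,b)‖₁ = |a| + |b|` on `ℝ²`. -/
noncomputable def l1 (dθ : ℝ × ℝ) : ℝ := |dθ.1| + |dθ.2|

/-- The initial-state measure
`μ₀ = ((1−ε)/2)·δ_{x⋆} + ((1−ε)/2)·δ_{y⋆} + (ε/10)·(Lebesgue restricted to (−5,5))`. -/
noncomputable def mu0 (δ ε : ℝ) : Measure ℝ :=
  ENNReal.ofReal ((1 - ε) / 2) • Measure.dirac (xstar δ) +
  ENNReal.ofReal ((1 - ε) / 2) • Measure.dirac (ystar δ) +
  ENNReal.ofReal (ε / 10) • (volume.restrict (Set.Ioo (-5 : ℝ) 5))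

theorem tent_eq_max {a δ : ℝ} (hδ : 0 < δ) (x : ℝ) : tent a δ x = max 0 (1 - |x - a| / δ) := by
  unfold tent
  simp only [Set.mem_Icc]
  split_ifs with h₁ h₂
  · rw [abs_of_nonpos (by linarith [h₁.2])]
    have : (x - (a - δ)) / δ = 1 - -(x - a) / δ := by field_simp; ring
    rw [← this, max_eq_right]
    exact div_nonneg (by linarith [h₁.1]) hδ.le
  · rw [abs_of_nonneg (by linarith [h₂.1])]
    have : (a + δ - x) / δ = 1 - (x - a) / δ := by field_simp; ring
    rw [← this, max_eq_right]
    exact div_nonneg (by linarith [h₂.2]) hδ.le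
  · rw [max_eq_left]
    rw [sub_nonpos, le_div_iff₀ hδ, one_mul, le_abs]
    by_contra! h
    rcases le_total x a with hx | hx
    · exact h₁ ⟨by linarith, hx⟩
    · exact h₂ ⟨hx, by linarith⟩

theorem tent_nonneg {a δ : ℝ} (hδ : 0 < δ) (x : ℝ) : 0 ≤ tent a δ x := by
  rw [tent_eq_max hδ]; exact le_max_left _ _

theorem tent_le_one {a δ : ℝ} (hδ : 0 < δ) (x : ℝ) : tent a δ x ≤ 1 := by
  rw [tent_eq_max hδ]
  exact max_le zero_le_one (by linarith [div_nonneg (abs_nonneg (x - a)) hδ.le])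

theorem tent_eq_zero {a δ x : ℝ} (hδ : 0 < δ) (h : δ ≤ |x - a|) : tent a δ x = 0 := by
  rw [tent_eq_max hδ, max_eq_left]
  rw [sub_nonpos, le_div_iff₀ hδ]; linarith

theorem tent_eq_of_abs_le {a δ x : ℝ} (hδ : 0 < δ) (h : |x - a| ≤ δ) :
    tent a δ x = 1 - |x - a| / δ := by
  rw [tent_eq_max hδ, max_eq_right]
  rw [sub_nonneg, div_le_iff₀ hδ]; linarith

theorem abs_tent_sub_le {a δ : ℝ} (hδ : 0 < δ) (x y : ℝ) :
    |tent a δ x - tent a δ y| ≤ |x - y| / δ := by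
  rw [tent_eq_max hδ, tent_eq_max hδ]
  have h := abs_max_sub_max_le_abs (1 - |x - a| / δ) (1 - |y - a| / δ) 0
  rw [max_comm 0, max_comm 0]
  refine h.trans ?_
  have e : 1 - |x - a| / δ - (1 - |y - a| / δ) = (|y - a| - |x - a|) / δ := by ring
  rw [e, abs_div, abs_of_pos hδ]
  refine div_le_div_of_nonneg_right ?_ hδ.le
  have := abs_abs_sub_abs_le (y - a) (x - a)
  rwa [sub_sub_sub_cancel_right, abs_sub_comm y x] at this

theorem continuous_tent {a δ : ℝ} (hδ : 0 < δ) : Continuous (tent a δ) := by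
  rw [show tent a δ = fun x => max 0 (1 - |x - a| / δ) from funext (tent_eq_max hδ)]
  fun_prop

theorem continuous_Fex {δ : ℝ} (hδ : 0 < δ) : Continuous (Fex δ) := by
  unfold Fex
  have h₁ := continuous_tent (a := -2) (δ := 0.1) (by norm_num)
  have h₂ := continuous_tent (a := 1.5) hδ
  have h₃ := continuous_tent (a := 1.8) hδ
  fun_prop

theorem abs_Fex_sub_le {δ : ℝ} (hδ : 0 < δ) (x y : ℝ) :
    |Fex δ x - Fex δ y| ≤ (31 + 1 / δ) * |x - y| := by
  have h₁ := abs_tent_sub_le (a := -2) (δ := 0.1) (by norm_num) x y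
  have h₂ := abs_tent_sub_le (a := 1.5) hδ x y
  have h₃ := abs_tent_sub_le (a := 1.8) hδ x y
  have h₀ := abs_abs_sub_abs_le x y
  have hd : 0 ≤ |x - y| / δ := by positivity
  have e : (31 + 1 / δ) * |x - y| = 31 * |x - y| + |x - y| / δ := by ring
  rw [e]
  have hd' : |x - y| / 0.1 = 10 * |x - y| := by ring
  rw [hd'] at h₁
  unfold Fex
  rw [abs_le] at *
  constructor <;> linarith [h₀.1, h₀.2, h₁.1, h₁.2, h₂.1, h₂.2, h₃.1, h₃.2]

theorem Fex_ge {δ : ℝ} (hδ : 0 < δ) (x : ℝ) : -0.5 * |x| ≤ Fex δ x := by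
  unfold Fex
  linarith [tent_nonneg (a := -2) (δ := 0.1) (by norm_num) x, tent_nonneg (a := 1.5) hδ x,
    tent_nonneg (a := 1.8) hδ x]

theorem Fex_of_le {δ x : ℝ} (hδ : 0 < δ) (hδ' : δ ≤ 0.01) (hx : x ≤ 1.2) :
    Fex δ x = -0.5 * |x| + 3 * tent (-2) 0.1 x := by
  unfold Fex
  rw [tent_eq_zero hδ (le_abs.2 (Or.inr (by linarith))),
    tent_eq_zero hδ (le_abs.2 (Or.inr (by linarith)))]
  ring

theorem Fex_of_abs_le {δ x : ℝ} (hδ : 0 < δ) (hδ' : δ ≤ 0.01) (hx : |x| ≤ 1.2) :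
    Fex δ x = -0.5 * |x| := by
  rw [abs_le] at hx
  rw [Fex_of_le hδ hδ' hx.2,
    tent_eq_zero (by norm_num) (le_abs.2 (Or.inl (by linarith [hx.1])))]
  ring

theorem Fex_le_of_ge {δ x : ℝ} (hδ : 0 < δ) (hx : -1.9 ≤ x) : Fex δ x ≤ 0.4 := by
  unfold Fex
  rw [tent_eq_zero (a := -2) (by norm_num) (le_abs.2 (Or.inl (by linarith)))]
  linarith [tent_le_one (a := 1.5) hδ x, tent_le_one (a := 1.8) hδ x, abs_nonneg x]

theorem Fex_le_two {δ : ℝ} (hδ : 0 < δ) (hδ' : δ ≤ 0.01) (x : ℝ) : Fex δ x ≤ 2 := by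
  rcases le_total (-1.9) x with hx | hx
  · linarith [Fex_le_of_ge hδ hx]
  · rw [Fex_of_le hδ hδ' (by linarith), abs_of_nonpos (by linarith), tent_eq_max (by norm_num)]
    rcases max_cases 0 (1 - |x - -2| / 0.1) with h | h
    · rw [h.1]; linarith
    · rw [h.1]
      have e : |x - -2| / 0.1 = 10 * |x - -2| := by ring
      rw [e]
      linarith [neg_le_abs (x - -2), le_abs_self (x - -2)]

/-- Near a center `c ∈ {1.5, 1.8}` of a narrow tent, only this tent contributes. -/
theorem Fex_near {δ c x : ℝ} (hδ : 0 < δ) (hδ' : δ ≤ 0.01) (hc : c = 1.5 ∨ c = 1.8)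
    (hx : |x - c| ≤ δ) : Fex δ x = -0.5 * x + 0.2 * (1 - |x - c| / δ) := by
  have h := abs_le.1 hx
  unfold Fex
  rw [← tent_eq_of_abs_le hδ hx]
  rcases hc with rfl | rfl
  · rw [tent_eq_zero (a := -2) (by norm_num) (le_abs.2 (Or.inl (by linarith [h.1]))),
      tent_eq_zero (a := 1.8) hδ (le_abs.2 (Or.inr (by linarith [h.2]))),
      abs_of_nonneg (by linarith [h.1])]
    ring
  · rw [tent_eq_zero (a := -2) (by norm_num) (le_abs.2 (Or.inl (by linarith [h.1]))),
      tent_eq_zero (a := 1.5) hδ (le_abs.2 (Or.inl (by linarith [h.1]))),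
      abs_of_nonneg (by linarith [h.1])]
    ring

/-- The smallest preimage of a level `c > 0` lies on the rising flank of the spike at `-2`. -/
theorem isLeast_Fex_preimage {δ c : ℝ} (hδ : 0 < δ) (hδ' : δ ≤ 0.01) (hc : 0 < c) (hc' : c ≤ 2) :
    IsLeast {x : ℝ | Fex δ x = c} ((c - 63) / 30.5) := by
  have key : ∀ x : ℝ, -2.1 ≤ x → x ≤ -2 → Fex δ x = 30.5 * x + 63 := by
    intro x h₁ h₂
    rw [Fex_of_le hδ hδ' (by linarith), abs_of_nonpos (by linarith),
      tent_eq_of_abs_le (by norm_num) (abs_le.2 ⟨by linarith, by linarith⟩),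
      abs_of_nonpos (by linarith)]
    ring
  have h₂ : (c - 63) / 30.5 ≤ -2 := by rw [div_le_iff₀ (by norm_num)]; linarith
  constructor
  · have h₁ : -2.1 ≤ (c - 63) / 30.5 := by rw [le_div_iff₀ (by norm_num)]; linarith
    simp only [Set.mem_ofPred_eq]
    rw [key _ h₁ h₂]
    ring
  · intro x hx
    simp only [Set.mem_ofPred_eq] at hx
    by_contra! hlt
    rcases le_total (-2.1) x with h | h
    · rw [key x h (by linarith)] at hx
      rw [lt_div_iff₀ (by norm_num)] at hlt
      linarith
    · rw [Fex_of_le hδ hδ' (by linarith), abs_of_nonpos (by linarith),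
        tent_eq_zero (by norm_num) (le_abs.2 (Or.inr (by linarith)))] at hx
      linarith

theorem xstar_eq {δ : ℝ} (hδ : 0 < δ) (hδ' : δ ≤ 0.01) : xstar δ = -123 / 61 := by
  rw [xstar, (isLeast_Fex_preimage hδ hδ' (by norm_num) (by norm_num)).csInf_eq]
  norm_num

theorem ystar_eq {δ : ℝ} (hδ : 0 < δ) (hδ' : δ ≤ 0.01) : ystar δ = -612 / 305 := by
  rw [ystar, (isLeast_Fex_preimage hδ hδ' (by norm_num) (by norm_num)).csInf_eq]
  norm_num

theorem Fex_xstar {δ : ℝ} (hδ : 0 < δ) (hδ' : δ ≤ 0.01) : Fex δ (xstar δ) = 1.5 := by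
  have h := isLeast_Fex_preimage hδ hδ' (c := 1.5) (by norm_num) (by norm_num)
  rw [xstar, h.csInf_eq]; exact h.1

theorem Fex_ystar {δ : ℝ} (hδ : 0 < δ) (hδ' : δ ≤ 0.01) : Fex δ (ystar δ) = 1.8 := by
  have h := isLeast_Fex_preimage hδ hδ' (c := 1.8) (by norm_num) (by norm_num)
  rw [ystar, h.csInf_eq]; exact h.1

theorem traj_succ (δ a b z : ℝ) (t : ℕ) :
    traj δ (a, b) z (t + 1) = a * traj δ (a, b) z t + b * Fex δ (traj δ (a, b) z t) := rfl

theorem continuous_traj {δ : ℝ} (hδ : 0 < δ) (a b : ℝ) (t : ℕ) :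
    Continuous fun z => traj δ (a, b) z t := by
  induction t with
  | zero => exact continuous_id
  | succ t ih =>
    simp only [traj_succ]
    exact (ih.const_mul _).add (((continuous_Fex hδ).comp ih).const_mul _)

/-- One closed-loop step is close to the feature if the parameters are close to `(0,1)`. -/
theorem abs_step_sub_Fex_le {δ x : ℝ} (a b : ℝ) (hδ : 0 < δ) (hδ' : δ ≤ 0.01) (hx : |x| ≤ 5) :
    |a * x + b * Fex δ x - Fex δ x| ≤ 5 * (|a| + |b - 1|) := by
  have hF : |Fex δ x| ≤ 5 :=
    abs_le.2 ⟨by linarith [Fex_ge hδ x], by linarith [Fex_le_two hδ hδ' x]⟩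
  have e : a * x + b * Fex δ x - Fex δ x = a * x + (b - 1) * Fex δ x := by ring
  rw [e]
  calc |a * x + (b - 1) * Fex δ x| ≤ |a| * |x| + |b - 1| * |Fex δ x| := by
        rw [← abs_mul, ← abs_mul]; exact abs_add_le _ _
    _ ≤ |a| * 5 + |b - 1| * 5 := by gcongr
    _ = _ := by ring

theorem abs_traj_le {δ a b z : ℝ} (hδ : 0 < δ) (hδ' : δ ≤ 0.01) (ha : |a| ≤ 0.001)
    (hb : |b - 1| ≤ 0.001) (hz : |z| ≤ 5) (t : ℕ) : |traj δ (a, b) z t| ≤ 5 := by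
  induction t with
  | zero => exact hz
  | succ t ih =>
    have h := abs_le.1 (abs_step_sub_Fex_le a b hδ hδ' ih)
    have h₁ := Fex_ge hδ (traj δ (a, b) z t)
    have h₂ := Fex_le_two hδ hδ' (traj δ (a, b) z t)
    rw [traj_succ]
    exact abs_le.2 ⟨by linarith [h.1], by linarith [h.2]⟩

/-- After three steps the trajectory stays in the region where the feature is contracting. -/
theorem abs_traj_add_three_le {δ a b z : ℝ} (hδ : 0 < δ) (hδ' : δ ≤ 0.01) (ha : |a| ≤ 0.001)
    (hb : |b - 1| ≤ 0.001) (hz : |z| ≤ 5) (t : ℕ) : |traj δ (a, b) z (t + 3)| ≤ 1.2 := by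
  have step : ∀ t, |traj δ (a, b) z (t + 1) - Fex δ (traj δ (a, b) z t)| ≤ 0.01 := by
    intro t
    rw [traj_succ]
    linarith [abs_step_sub_Fex_le a b hδ hδ' (abs_traj_le hδ hδ' ha hb hz t)]
  have B := abs_traj_le hδ hδ' ha hb hz
  have S := fun t => abs_le.1 (step t)
  have G := fun t => Fex_ge hδ (traj δ (a, b) z t)
  have T := fun t => Fex_le_two hδ hδ' (traj δ (a, b) z t)
  induction t with
  | zero =>
    have h₁ : |traj δ (a, b) z 1| ≤ 2.51 :=
      abs_le.2 ⟨by linarith [(S 0).1, G 0, B 0], by linarith [(S 0).2, T 0]⟩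
    have h₂ : -1.3 ≤ traj δ (a, b) z 2 := by linarith [(S 1).1, G 1]
    have h₂' : traj δ (a, b) z 2 ≤ 2.01 := by linarith [(S 1).2, T 1]
    have h₂'' : |traj δ (a, b) z 2| ≤ 2.01 := abs_le.2 ⟨by linarith, h₂'⟩
    have h₃ := Fex_le_of_ge hδ (x := traj δ (a, b) z 2) (by linarith)
    exact abs_le.2 ⟨by linarith [(S 2).1, G 2], by linarith [(S 2).2]⟩
  | succ t ih =>
    have e := Fex_of_abs_le hδ hδ' ih
    have s := S (t + 3)
    rw [e] at s
    have := abs_nonneg (traj δ (a, b) z (t + 3))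
    exact abs_le.2 ⟨by linarith [s.1], by linarith [s.2]⟩

/-- Trajectories are Lipschitz in the parameters at `(0,1)`, uniformly in time. -/
theorem abs_traj_sub_le {δ a b z : ℝ} (hδ : 0 < δ) (hδ' : δ ≤ 0.01) (ha : |a| ≤ 0.001)
    (hb : |b| ≤ 0.001) (hz : |z| ≤ 5) (t : ℕ) :
    |traj δ (a, 1 + b) z t - traj δ (0, 1) z t| ≤
      5 * (1 + (31 + 1 / δ) + (31 + 1 / δ) ^ 2) * (|a| + |b|) := by
  set L := 31 + 1 / δ with hL
  set s := |a| + |b| with hs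
  have hL1 : 31 ≤ L := by
    have : 0 < 1 / δ := by positivity
    linarith
  have hs0 : 0 ≤ s := by positivity
  have h0 : |(0 : ℝ)| ≤ 0.001 := by norm_num
  have h1 : |(1 : ℝ) - 1| ≤ 0.001 := by norm_num
  have hb1 : |1 + b - 1| ≤ 0.001 := by simpa using hb
  have step : ∀ t, |traj δ (a, 1 + b) z (t + 1) - traj δ (0, 1) z (t + 1)| ≤
      5 * s + |Fex δ (traj δ (a, 1 + b) z t) - Fex δ (traj δ (0, 1) z t)| := by
    intro t
    have h := abs_step_sub_Fex_le a (1 + b) hδ hδ' (abs_traj_le hδ hδ' ha hb1 hz t)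
    rw [add_sub_cancel_left] at h
    rw [traj_succ, traj_succ]
    have := abs_sub_le (a * traj δ (a, 1 + b) z t + (1 + b) * Fex δ (traj δ (a, 1 + b) z t))
      (Fex δ (traj δ (a, 1 + b) z t)) (Fex δ (traj δ (0, 1) z t))
    rw [zero_mul, zero_add, one_mul]
    linarith
  have lip : ∀ t, |traj δ (a, 1 + b) z (t + 1) - traj δ (0, 1) z (t + 1)| ≤
      5 * s + L * |traj δ (a, 1 + b) z t - traj δ (0, 1) z t| := fun t =>
    (step t).trans (by gcongr; exact abs_Fex_sub_le hδ _ _)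
  have hLs : 0 ≤ L * s := by positivity
  have hLLs : 0 ≤ L ^ 2 * s := by positivity
  have e0 : |traj δ (a, 1 + b) z 0 - traj δ (0, 1) z 0| = 0 := by simp [traj]
  have e1 : |traj δ (a, 1 + b) z 1 - traj δ (0, 1) z 1| ≤ 5 * s := by
    have := lip 0
    rw [e0, mul_zero] at this
    linarith
  have e2 : |traj δ (a, 1 + b) z 2 - traj δ (0, 1) z 2| ≤ 5 * s + L * (5 * s) :=
    (lip 1).trans (by gcongr)
  have e3 : |traj δ (a, 1 + b) z 3 - traj δ (0, 1) z 3| ≤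
      5 * s + L * (5 * s + L * (5 * s)) := (lip 2).trans (by gcongr)
  match t with
  | 0 => rw [e0]; positivity
  | 1 => linarith
  | 2 => linarith
  | t + 3 =>
    induction t with
    | zero => linarith
    | succ t ih =>
      have h := step (t + 3)
      rw [Fex_of_abs_le hδ hδ' (abs_traj_add_three_le hδ hδ' ha hb1 hz t),
        Fex_of_abs_le hδ hδ' (abs_traj_add_three_le hδ hδ' h0 h1 hz t), ← mul_sub, abs_mul,
        show |(-0.5 : ℝ)| = 0.5 by norm_num] at h
      have h' := abs_abs_sub_abs_le (traj δ (a, 1 + b) z (t + 3)) (traj δ (0, 1) z (t + 3))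
      have hLs' : 31 * s ≤ L * s := by gcongr
      rw [show t + 1 + 3 = t + 3 + 1 by ring]
      calc _ ≤ 5 * s + 0.5 * (5 * (1 + L + L ^ 2) * s) := by
            refine h.trans ?_; gcongr; exact h'.trans ih
        _ ≤ _ := by linarith

theorem abs_cost_term_le {γ R x y : ℝ} (hγ : γ ∈ Set.Ioo (0 : ℝ) 1) (hR : R ∈ Set.Ioo (0 : ℝ) γ)
    (hx : |x| ≤ 5) (hy : |y| ≤ 5) (t : ℕ) : ‖γ ^ t * (x ^ 2 + R * y ^ 2)‖ ≤ 50 * γ ^ t := by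
  have h₁ : x ^ 2 ≤ 25 := by nlinarith [sq_abs x, abs_nonneg x]
  have h₂ : y ^ 2 ≤ 25 := by nlinarith [sq_abs y, abs_nonneg y]
  have hγt : 0 < γ ^ t := pow_pos hγ.1 t
  have hR0 := hR.1
  have hR1 : R ≤ 1 := (hR.2.trans hγ.2).le
  rw [Real.norm_of_nonneg (by positivity)]
  have : R * y ^ 2 ≤ 1 * 25 := by gcongr
  nlinarith

theorem summable_geom_mul {γ : ℝ} (hγ : γ ∈ Set.Ioo (0 : ℝ) 1) (K : ℝ) :
    Summable fun t : ℕ => K * γ ^ t :=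
  (summable_geometric_of_lt_one hγ.1.le hγ.2).mul_left K

theorem summable_cost {γ R δ a b z : ℝ} (hγ : γ ∈ Set.Ioo (0 : ℝ) 1) (hR : R ∈ Set.Ioo (0 : ℝ) γ)
    (hδ : 0 < δ) (hδ' : δ ≤ 0.01) (ha : |a| ≤ 0.001) (hb : |b - 1| ≤ 0.001) (hz : |z| ≤ 5) :
    Summable fun t : ℕ =>
      γ ^ t * ((traj δ (a, b) z t) ^ 2 + R * (traj δ (a, b) z (t + 1)) ^ 2) :=
  Summable.of_norm_bounded (summable_geom_mul hγ 50) fun t =>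
    abs_cost_term_le hγ hR (abs_traj_le hδ hδ' ha hb hz t)
      (abs_traj_le hδ hδ' ha hb hz (t + 1)) t

theorem integrableOn_cost {γ R δ a b : ℝ} (hγ : γ ∈ Set.Ioo (0 : ℝ) 1)
    (hR : R ∈ Set.Ioo (0 : ℝ) γ) (hδ : 0 < δ) (hδ' : δ ≤ 0.01) (ha : |a| ≤ 0.001)
    (hb : |b - 1| ≤ 0.001) : IntegrableOn (cost γ R δ (a, b)) (Set.Ioo (-5) 5) := by
  refine IntegrableOn.mono_set (ContinuousOn.integrableOn_Icc ?_) Set.Ioo_subset_Icc_self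
  unfold cost
  refine continuousOn_tsum (fun t => Continuous.continuousOn ?_) (summable_geom_mul hγ 50) ?_
  · have h₁ := continuous_traj hδ a b t
    have h₂ := continuous_traj hδ a b (t + 1)
    fun_prop
  · intro t z hz
    have hz' : |z| ≤ 5 := abs_le.2 hz
    exact abs_cost_term_le hγ hR (abs_traj_le hδ hδ' ha hb hz' t)
      (abs_traj_le hδ hδ' ha hb hz' (t + 1)) t

/-- A pathwise lower bound on the squared states, sharpened at time `2`, bounds the cost. -/
theorem cost_sub_ge {γ R δ a b z K q : ℝ} (hγ : γ ∈ Set.Ioo (0 : ℝ) 1)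
    (hR : R ∈ Set.Ioo (0 : ℝ) γ) (hδ : 0 < δ) (hδ' : δ ≤ 0.01) (ha : |a| ≤ 0.001)
    (hb : |b| ≤ 0.001) (hz : |z| ≤ 5) (hK : 0 ≤ K)
    (h : ∀ t, (traj δ (0, 1) z t) ^ 2 - K ≤ (traj δ (a, 1 + b) z t) ^ 2)
    (h₂ : (traj δ (0, 1) z 2) ^ 2 + q - K ≤ (traj δ (a, 1 + b) z 2) ^ 2) :
    γ ^ 2 * q - 2 * K / (1 - γ) ≤ cost γ R δ (a, 1 + b) z - cost γ R δ (0, 1) z := by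
  have h0 : |(0 : ℝ)| ≤ 0.001 := by norm_num
  have h1 : |(1 : ℝ) - 1| ≤ 0.001 := by norm_num
  have S₁ := summable_cost (b := 1 + b) hγ hR hδ hδ' ha (by simpa using hb) hz
  have S₀ := summable_cost hγ hR hδ hδ' h0 h1 hz
  have S₂ := summable_geom_mul hγ (2 * K)
  have S := (S₁.sub S₀).add S₂
  have hR0 := hR.1
  have hR1 : R ≤ 1 := (hR.2.trans hγ.2).le
  have hRK : R * K ≤ K := mul_le_of_le_one_left hK hR1
  have hstep := fun t => mul_le_mul_of_nonneg_left (h t) hR0.le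
  have hterm : ∀ t, γ ^ t * ((traj δ (a, 1 + b) z t) ^ 2 - (traj δ (0, 1) z t) ^ 2 + K) ≤
      γ ^ t * ((traj δ (a, 1 + b) z t) ^ 2 + R * (traj δ (a, 1 + b) z (t + 1)) ^ 2) -
      γ ^ t * ((traj δ (0, 1) z t) ^ 2 + R * (traj δ (0, 1) z (t + 1)) ^ 2) +
      2 * K * γ ^ t := by
    intro t
    have := mul_nonneg (pow_pos hγ.1 t).le (a := γ ^ t)
      (b := R * (traj δ (a, 1 + b) z (t + 1)) ^ 2 - R * (traj δ (0, 1) z (t + 1)) ^ 2 + K)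
      (by linarith [hstep (t + 1)])
    linarith
  have hle := S.le_tsum 2 fun t _ => le_trans
    (mul_nonneg (pow_pos hγ.1 t).le (by linarith [h t])) (hterm t)
  rw [(S₁.sub S₀).tsum_add S₂, S₁.tsum_sub S₀, tsum_mul_left,
    tsum_geometric_of_lt_one hγ.1.le hγ.2] at hle
  have hq : γ ^ 2 * q ≤
      γ ^ 2 * ((traj δ (a, 1 + b) z 2) ^ 2 - (traj δ (0, 1) z 2) ^ 2 + K) :=
    mul_le_mul_of_nonneg_left (by linarith) (pow_pos hγ.1 2).le
  have := (hq.trans (hterm 2)).trans hle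
  rw [div_eq_mul_inv, sub_le_iff_le_add]
  exact this

/-- The cost decreases at most linearly in the parameter perturbation. -/
theorem cost_sub_ge_lipschitz {γ R δ a b z : ℝ} (hγ : γ ∈ Set.Ioo (0 : ℝ) 1)
    (hR : R ∈ Set.Ioo (0 : ℝ) γ) (hδ : 0 < δ) (hδ' : δ ≤ 0.01) (ha : |a| ≤ 0.001)
    (hb : |b| ≤ 0.001) (hz : |z| ≤ 5) :
    -(100 * (1 + (31 + 1 / δ) + (31 + 1 / δ) ^ 2) / (1 - γ) * (|a| + |b|)) ≤
      cost γ R δ (a, 1 + b) z - cost γ R δ (0, 1) z := by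
  have h0 : |(0 : ℝ)| ≤ 0.001 := by norm_num
  have h1 : |(1 : ℝ) - 1| ≤ 0.001 := by norm_num
  set E := 5 * (1 + (31 + 1 / δ) + (31 + 1 / δ) ^ 2) * (|a| + |b|) with hE
  have hE0 : 0 ≤ E := by positivity
  have key : ∀ t, (traj δ (0, 1) z t) ^ 2 - 10 * E ≤ (traj δ (a, 1 + b) z t) ^ 2 := by
    intro t
    have h₁ := abs_traj_sub_le hδ hδ' ha hb hz t
    have h₂ := abs_traj_le hδ hδ' h0 h1 hz t
    have h₃ : |traj δ (0, 1) z t * (traj δ (a, 1 + b) z t - traj δ (0, 1) z t)| ≤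
        5 * E := by rw [abs_mul]; gcongr
    nlinarith [(abs_le.1 h₃).1, sq_nonneg (traj δ (a, 1 + b) z t - traj δ (0, 1) z t)]
  have := cost_sub_ge (q := 0) hγ hR hδ hδ' ha hb hz (by positivity) key (by simpa using key 2)
  refine le_trans (le_of_eq ?_) this
  rw [hE]; ring

theorem Fex_of_nonpos {δ x : ℝ} (hδ : 0 < δ) (hδ' : δ ≤ 0.01) (hx : x ∈ Set.Icc (-1.2) 0) :
    Fex δ x = 0.5 * x := by
  rw [Fex_of_abs_le hδ hδ' (abs_le.2 ⟨hx.1, by linarith [hx.2]⟩), abs_of_nonpos hx.2]; ring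

/-- The interval `[-1.2, 0]` is forward invariant. -/
theorem traj_add_mem {δ a b z : ℝ} {T : ℕ} (hδ : 0 < δ) (hδ' : δ ≤ 0.01) (ha : |a| ≤ 0.001)
    (hb : |b - 1| ≤ 0.001) (hz : traj δ (a, b) z T ∈ Set.Icc (-1.2) 0) (t : ℕ) :
    traj δ (a, b) z (t + T) ∈ Set.Icc (-1.2) 0 := by
  induction t with
  | zero => rwa [zero_add]
  | succ t ih =>
    rw [add_right_comm, traj_succ, Fex_of_nonpos hδ hδ' ih]
    have haa := abs_le.1 ha
    have hbb := abs_le.1 hb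
    have h₁ : 0 ≤ a + b * 0.5 := by linarith
    have h₂ : a + b * 0.5 ≤ 1 := by linarith
    have h₃ := mul_nonneg (sub_nonneg.2 h₂) (neg_nonneg.2 ih.2)
    have h₄ := mul_nonneg h₁ (neg_nonneg.2 ih.2)
    constructor <;> linarith only [h₃, h₄, ih.1]

/-- On the invariant interval `[-1.2, 0]`, one-sided bounds between trajectories persist. -/
theorem traj_add_le {δ a b z : ℝ} {T : ℕ} (hδ : 0 < δ) (hδ' : δ ≤ 0.01)
    (hX : ∀ t, traj δ (a, 1 + b) z (t + T) ∈ Set.Icc (-1.2) 0)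
    (hY : ∀ t, traj δ (0, 1) z (t + T) ∈ Set.Icc (-1.2) 0)
    (hT : traj δ (a, 1 + b) z T ≤ traj δ (0, 1) z T + 20 * (|a| + |b|)) (t : ℕ) :
    traj δ (a, 1 + b) z (t + T) ≤ traj δ (0, 1) z (t + T) + 20 * (|a| + |b|) := by
  induction t with
  | zero => rwa [zero_add]
  | succ t ih =>
    rw [add_right_comm, traj_succ, traj_succ, Fex_of_nonpos hδ hδ' (hX t),
      Fex_of_nonpos hδ hδ' (hY t)]
    have hx : |traj δ (a, 1 + b) z (t + T)| ≤ 2 :=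
      abs_le.2 ⟨by linarith [(hX t).1], by linarith [(hX t).2]⟩
    have h : ∀ u : ℝ, u * traj δ (a, 1 + b) z (t + T) ≤ |u| * 2 := fun u =>
      (le_abs_self _).trans (by rw [abs_mul]; gcongr)
    linarith only [h a, h b, ih, abs_nonneg a, abs_nonneg b]

/-- If `F w = c` is the center of a narrow tent, then the cost started at `w` increases steeply
along parameter perturbations which move the first successor of `w` off the center. -/
theorem cost_sub_ge_steep {γ R δ a b w c : ℝ} (hγ : γ ∈ Set.Ioo (0 : ℝ) 1)
    (hR : R ∈ Set.Ioo (0 : ℝ) γ) (hδ : 0 < δ) (hδ' : δ ≤ 0.01) (ha : |a| ≤ δ / 10)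
    (hb : |b| ≤ δ / 10) (hc : c = 1.5 ∨ c = 1.8) (hw : |w| ≤ 3) (hF : Fex δ w = c) :
    γ ^ 2 * (0.1 * (|a * w + b * c| / δ)) - 2 * (48 * (|a| + |b|)) / (1 - γ) ≤
      cost γ R δ (a, 1 + b) w - cost γ R δ (0, 1) w := by
  have ha' : |a| ≤ 0.001 := by linarith
  have hb' : |b| ≤ 0.001 := by linarith
  set s := |a| + |b| with hs
  set p := a * w + b * c with hp
  have hs0 : 0 ≤ s := by positivity
  have hcb : 1.5 ≤ c ∧ c ≤ 1.8 := by rcases hc with rfl | rfl <;> norm_num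
  have hps : |p| ≤ 3 * s := by
    calc |p| ≤ |a| * |w| + |b| * |c| := by rw [← abs_mul, ← abs_mul]; exact abs_add_le _ _
      _ ≤ |a| * 3 + |b| * 3 := by
        gcongr; rw [abs_of_nonneg (by linarith)]; linarith
      _ = 3 * s := by rw [hs]; ring
  have hpδ : |p| ≤ δ := by linarith
  have hpp := abs_le.1 hps
  have hpd := abs_le.1 hpδ
  have haa := abs_le.1 ha'
  have hbb := abs_le.1 hb'
  set d := |p| / δ with hd
  have hd0 : 0 ≤ d := by positivity
  have hd1 : d ≤ 1 := (div_le_one hδ).2 hpδ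
  have x1 : traj δ (a, 1 + b) w 1 = c + p := by
    simp only [traj, hF, hp]; ring
  have y1 : traj δ (0, 1) w 1 = c := by
    simp only [traj, hF]; ring
  have hFx : Fex δ (c + p) = -0.5 * (c + p) + 0.2 * (1 - d) := by
    rw [Fex_near hδ hδ' hc (by simpa using hpδ)]; simp [hd]
  have hFc : Fex δ c = -0.5 * c + 0.2 := by
    rw [Fex_near hδ hδ' hc (by simpa using hδ.le)]; simp
  have x2 : traj δ (a, 1 + b) w 2 = a * (c + p) + (1 + b) * (-0.5 * (c + p) + 0.2 * (1 - d)) := by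
    rw [traj_succ, x1, hFx]
  have y2 : traj δ (0, 1) w 2 = -0.5 * c + 0.2 := by
    rw [traj_succ, y1, hFc]; ring
  have hprod : ∀ u v B : ℝ, |v| ≤ B → -(|u| * B) ≤ u * v ∧ u * v ≤ |u| * B := by
    intro u v B h
    refine abs_le.1 ?_
    rw [abs_mul]; gcongr
  have hm₁ := hprod a (c + p) 2 (abs_le.2 ⟨by linarith, by linarith⟩)
  have hm₂ := hprod b (-0.5 * (c + p) + 0.2 * (1 - d)) 2
    (abs_le.2 ⟨by linarith, by linarith⟩)
  have hm₃ := hprod b (-0.5 * (c + p) + 0.2) 2 (abs_le.2 ⟨by linarith, by linarith⟩)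
  have hbd : 0 ≤ (0.5 + b) * d := mul_nonneg (by linarith) hd0
  have hX := traj_add_mem (a := a) (b := 1 + b) (T := 2) hδ hδ' ha' (by simpa using hb')
    (z := w) (by rw [x2]; constructor <;> linarith)
  have hY := traj_add_mem (a := 0) (b := 1) (T := 2) hδ hδ' (by norm_num) (by norm_num)
    (z := w) (by rw [y2]; constructor <;> linarith)
  have hdiff2 : traj δ (a, 1 + b) w 2 ≤ traj δ (0, 1) w 2 + 20 * s - 0.1 * d := by
    rw [x2, y2]
    linarith
  have hdiff := traj_add_le hδ hδ' hX hY (by linarith)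
  have hsq : ∀ {x y : ℝ}, -1.2 ≤ y → y ≤ 0 → x ≤ y + 20 * s → y ^ 2 - 48 * s ≤ x ^ 2 := by
    intro x y h₁ h₂ h₃
    have h₄ := mul_nonneg_of_nonpos_of_nonpos h₂ (sub_nonpos.2 h₃)
    have h₅ := mul_le_mul_of_nonneg_right h₁ hs0
    nlinarith only [h₄, h₅, sq_nonneg (x - y)]
  refine cost_sub_ge hγ hR hδ hδ' ha' hb' (by linarith) (by positivity) ?_ ?_
  · intro t
    match t with
    | 0 => simp only [traj]; linarith
    | 1 => rw [x1, y1]; nlinarith [sq_nonneg p]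
    | t + 2 => exact hsq (hY t).1 (hY t).2 (hdiff t)
  · have h := (hY 0).1
    rw [zero_add] at h
    have hv : traj δ (0, 1) w 2 ≤ -0.5 := by rw [y2]; linarith
    have h₁ := mul_nonneg_of_nonpos_of_nonpos (hv.trans (by norm_num : (-0.5 : ℝ) ≤ 0))
      (sub_nonpos.2 hdiff2)
    have h₂ := mul_le_mul_of_nonneg_right h hs0
    have h₃ := mul_le_mul_of_nonneg_right hv hd0
    nlinarith only [h₁, h₂, h₃, sq_nonneg (traj δ (a, 1 + b) w 2 - traj δ (0, 1) w 2)]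

theorem integral_mu0 {δ ε : ℝ} {f : ℝ → ℝ} (hε : ε ∈ Set.Ioo (0 : ℝ) 1)
    (hf : IntegrableOn f (Set.Ioo (-5) 5)) :
    ∫ z, f z ∂(mu0 δ ε) =
      (1 - ε) / 2 * f (xstar δ) + (1 - ε) / 2 * f (ystar δ) +
        ε / 10 * ∫ z in Set.Ioo (-5 : ℝ) 5, f z := by
  have hd : ∀ w, Integrable f (ENNReal.ofReal ((1 - ε) / 2) • Measure.dirac w) := fun w =>
    (integrable_dirac (by simp)).smul_measure ENNReal.ofReal_ne_top
  have hl : Integrable f (ENNReal.ofReal (ε / 10) • volume.restrict (Set.Ioo (-5 : ℝ) 5)) :=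
    Integrable.smul_measure hf ENNReal.ofReal_ne_top
  have h₁ : 0 ≤ (1 - ε) / 2 := by linarith [hε.2]
  have h₂ : 0 ≤ ε / 10 := by linarith [hε.1]
  rw [mu0, integral_add_measure ((hd _).add_measure (hd _)) hl,
    integral_add_measure (hd _) (hd _), integral_smul_measure, integral_smul_measure,
    integral_smul_measure, integral_dirac, integral_dirac, ENNReal.toReal_ofReal h₁,
    ENNReal.toReal_ofReal h₂]
  simp only [smul_eq_mul]

/-- The displacements of the first successors of `x⋆` and `y⋆` control the perturbation. -/
theorem perturbation_le {δ : ℝ} (hδ : 0 < δ) (hδ' : δ ≤ 0.01) (a b : ℝ) :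
    |a| + |b| ≤ 7 * (|a * xstar δ + b * 1.5| + |a * ystar δ + b * 1.8|) := by
  rw [xstar_eq hδ hδ', ystar_eq hδ hδ']
  rcases abs_cases a with h₁ | h₁ <;> rcases abs_cases b with h₂ | h₂ <;>
    rcases abs_cases (a * (-123 / 61) + b * 1.5) with h₃ | h₃ <;>
    rcases abs_cases (a * (-612 / 305) + b * 1.8) with h₄ | h₄ <;> linarith

/-- The paper's counterexample: for suitable tent width `δ` and weight `ε`, the
parameter point `θ = (0,1)` is a strict local minimum of the total LQR cost
`𝒞(θ) = ∫ C[z](θ) dμ₀(z)`. -/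
theorem counterexample_local_min (γ R : ℝ)
    (hγ : γ ∈ Set.Ioo (0 : ℝ) 1) (hR : R ∈ Set.Ioo (0 : ℝ) γ) :
    ∃ δ > (0 : ℝ), ∃ ε ∈ Set.Ioo (0 : ℝ) 1, ∃ r > (0 : ℝ),
      ∀ dθ : ℝ × ℝ, dθ ≠ 0 → ‖dθ‖ < r →
        (∫ z, cost γ R δ ((0, 1) : ℝ × ℝ) z ∂(mu0 δ ε)) <
          ∫ z, cost γ R δ (((0, 1) : ℝ × ℝ) + dθ) z ∂(mu0 δ ε) := by
  have hγ0 := hγ.1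
  have hγ1 : 0 < 1 - γ := by linarith [hγ.2]
  set P := 200 / (1 - γ) + 1 with hP
  have hP0 : 0 < P := by positivity
  obtain ⟨δ, hδ, hδ', hδP⟩ : ∃ δ : ℝ, 0 < δ ∧ δ ≤ 0.01 ∧ P * (70 * δ) ≤ γ ^ 2 := by
    refine ⟨min 0.01 (γ ^ 2 / (70 * P)), by positivity, min_le_left _ _, ?_⟩
    calc P * (70 * min 0.01 (γ ^ 2 / (70 * P))) ≤ P * (70 * (γ ^ 2 / (70 * P))) := by
          gcongr; exact min_le_right _ _
      _ = γ ^ 2 := by field_simp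
  set M := 100 * (1 + (31 + 1 / δ) + (31 + 1 / δ) ^ 2) / (1 - γ) with hM
  have hM0 : 0 < M := by positivity
  set ε := 1 / (2 * M + 2) with hε
  have hεM : ε * (2 * M + 2) = 1 := by rw [hε]; field_simp
  have hε0 : 0 < ε := by positivity
  have hεI : ε ∈ Set.Ioo (0 : ℝ) 1 := ⟨hε0, by nlinarith [mul_pos hε0 hM0]⟩
  refine ⟨δ, hδ, ε, hεI, δ / 10, by positivity, ?_⟩
  rintro ⟨a, b⟩ hne hr
  have ha : |a| ≤ δ / 10 := ((norm_fst_le (a, b)).trans hr.le)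
  have hb : |b| ≤ δ / 10 := ((norm_snd_le (a, b)).trans hr.le)
  have ha' : |a| ≤ 0.001 := by linarith
  have hb' : |b| ≤ 0.001 := by linarith
  have hs : 0 < |a| + |b| := by
    by_contra! h
    have h₁ : a = 0 := abs_eq_zero.1 (by linarith [abs_nonneg a, abs_nonneg b])
    have h₂ : b = 0 := abs_eq_zero.1 (by linarith [abs_nonneg a, abs_nonneg b])
    exact hne (by simp [h₁, h₂])
  set s := |a| + |b| with hsdef
  have e₁ : ((0, 1) : ℝ × ℝ) + (a, b) = (a, 1 + b) := by simp
  rw [e₁]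
  have I₁ := integrableOn_cost (b := 1 + b) hγ hR hδ hδ' ha' (by simpa using hb')
  have I₀ := integrableOn_cost (a := 0) (b := 1) hγ hR hδ hδ' (by norm_num) (by norm_num)
  rw [integral_mu0 hεI I₁, integral_mu0 hεI I₀]
  have hL : -(M * s) * 10 ≤ (∫ z in Set.Ioo (-5 : ℝ) 5, cost γ R δ (a, 1 + b) z) -
      ∫ z in Set.Ioo (-5 : ℝ) 5, cost γ R δ (0, 1) z := by
    rw [← integral_sub I₁ I₀]
    have : ∫ z in Set.Ioo (-5 : ℝ) 5, -(M * s) = -(M * s) * 10 := by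
      simp; norm_num; ring
    rw [← this]
    refine setIntegral_mono_on (integrableOn_const (by simp)) (I₁.sub I₀) measurableSet_Ioo fun z hz => ?_
    exact cost_sub_ge_lipschitz hγ hR hδ hδ' ha' hb' (abs_le.2 ⟨hz.1.le, hz.2.le⟩)
  have hx := cost_sub_ge_steep hγ hR hδ hδ' ha hb (Or.inl rfl)
    (by rw [xstar_eq hδ hδ']; norm_num [abs_le]) (Fex_xstar hδ hδ')
  have hy := cost_sub_ge_steep hγ hR hδ hδ' ha hb (Or.inr rfl)
    (by rw [ystar_eq hδ hδ']; norm_num [abs_le]) (Fex_ystar hδ hδ')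
  have hp := perturbation_le hδ hδ' a b
  rw [← hsdef] at hx hy hp
  set p := |a * xstar δ + b * 1.5|
  set q := |a * ystar δ + b * 1.8|
  have hgain : P * s ≤ γ ^ 2 * (0.1 * (p / δ)) + γ ^ 2 * (0.1 * (q / δ)) := by
    have e : γ ^ 2 * (0.1 * (p / δ)) + γ ^ 2 * (0.1 * (q / δ)) =
        γ ^ 2 * (7 * (p + q)) / (70 * δ) := by field_simp; ring
    rw [e, le_div_iff₀ (by positivity)]
    calc P * s * (70 * δ) = P * (70 * δ) * s := by ring
      _ ≤ γ ^ 2 * (7 * (p + q)) := by gcongr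
  have hloss : 2 * (48 * s) / (1 - γ) * 2 ≤ (P - 1) * s := by
    have e : (P - 1) * s - 2 * (48 * s) / (1 - γ) * 2 = 8 * s / (1 - γ) := by rw [hP]; ring
    have : 0 ≤ 8 * s / (1 - γ) := by positivity
    linarith
  have hD : s ≤ (cost γ R δ (a, 1 + b) (xstar δ) - cost γ R δ (0, 1) (xstar δ)) +
      (cost γ R δ (a, 1 + b) (ystar δ) - cost γ R δ (0, 1) (ystar δ)) := by
    linarith only [hx, hy, hgain, hloss]
  have h₁ := mul_le_mul_of_nonneg_left hD (show 0 ≤ (1 - ε) / 2 by linarith [hεI.2])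
  have h₂ := mul_le_mul_of_nonneg_left hL (show 0 ≤ ε / 10 by positivity)
  have h₃ : (1 - ε) / 2 * s - ε * M * s = ε / 2 * s := by
    linear_combination (-s / 2) * hεM
  have h₄ : 0 < ε / 2 * s := by positivity
  linarith
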